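/- arXiv:1809.05774 — 4 statements merged into one kernel-verified Lean document; each statement's English description precedes it below -/
import Mathlib

section
/- Let δ_k = k,(k−1),…,1 denote the decreasing permutation of size k. For any permutation π other than the permutations 1 and 12, one has ∑_{k=1}^{|π|} μ(δ_k, π) = 0. -/
open scoped Classical

noncomputable section

/-- A finite permutation: a size `n` together with a permutation of `Fin n`.
Positions and values are 0-indexed here; the paper's 1-indexed sequence
`π(1), …, π(n)` corresponds to the map `p ↦ π(p+1) - 1`. -/
abbrev PPerm : Type := Σ n : ℕ, Equiv.Perm (Fin n)

namespace PPerm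

/-- `IsEmb σ π f` : `f` is an embedding of the permutation `σ` into the permutation `π`,
i.e. `f` is strictly increasing and the values of `π` along `f` are ordered as the values
of `σ`. -/
def IsEmb (σ π : PPerm) (f : Fin σ.1 → Fin π.1) : Prop :=
  StrictMono f ∧ ∀ i j : Fin σ.1, σ.2 i < σ.2 j ↔ π.2 (f i) < π.2 (f j)

/-- The pattern-containment order on finite permutations: `Le σ π` iff some embedding
of `σ` into `π` exists. -/
def Le (σ π : PPerm) : Prop := ∃ f, IsEmb σ π f

lemma Le.size_le {σ π : PPerm} (h : Le σ π) : σ.1 ≤ π.1 := by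
  obtain ⟨f, hf⟩ := h
  simpa using Fintype.card_le_of_injective f hf.1.injective

lemma strictMono_fin_eq_id {n : ℕ} {f : Fin n → Fin n} (hf : StrictMono f) : f = id := by
  have hsurj : Function.Surjective f := Finite.surjective_of_injective hf.injective
  have he : (StrictMono.orderIsoOfSurjective f hf hsurj) = OrderIso.refl (Fin n) :=
    Subsingleton.elim _ _
  funext i
  have h2 := congrArg (fun e : Fin n ≃o Fin n => e i) he
  simpa using h2

lemma Le.eq_of_size_eq {σ π : PPerm} (h : Le σ π) (hs : σ.1 = π.1) : σ = π := by
  obtain ⟨n, s⟩ := σ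
  obtain ⟨n', p⟩ := π
  simp only at hs
  subst hs
  obtain ⟨f, hf, hpat⟩ := h
  have hid : f = id := strictMono_fin_eq_id hf
  subst hid
  have key : ∀ i j, s i < s j ↔ p i < p j := by simpa using hpat
  have hF : StrictMono (fun u => p (s.symm u)) := by
    intro u v huv
    have h1 : s (s.symm u) < s (s.symm v) := by simpa using huv
    exact (key _ _).mp h1
  have hFid : (fun u => p (s.symm u)) = id := strictMono_fin_eq_id hF
  have hps : ∀ w, p w = s w := by
    intro w
    have := congrFun hFid (s w)
    simpa using this
  have : p = s := Equiv.ext hps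
  subst this
  rfl

/-- All permutations of size `k`, as a finite set. -/
def permsOfSize (k : ℕ) : Finset PPerm :=
  Finset.univ.image (fun p : Equiv.Perm (Fin k) => (⟨k, p⟩ : PPerm))

/-- All permutations of size at most `N`, as a finite set. -/
def permsUpTo (N : ℕ) : Finset PPerm :=
  (Finset.range (N + 1)).biUnion permsOfSize

lemma size_le_of_mem_permsUpTo {N : ℕ} {z : PPerm} (h : z ∈ permsUpTo N) : z.1 ≤ N := by
  simp only [permsUpTo, permsOfSize, Finset.mem_biUnion, Finset.mem_range,
    Finset.mem_image, Finset.mem_univ, true_and] at h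
  obtain ⟨k, hk, p, rfl⟩ := h
  show k ≤ N
  omega

/-- The Möbius function of the pattern-containment poset of permutations:
`mu x y = 0` if `x ≰ y`, `mu x x = 1`, and `mu x y = -∑_{z ∈ [x,y)} mu x z` if `x < y`,
where `[x,y)` is the (finite) set of permutations `z` with `x ≤ z ≤ y` and `z ≠ y`. -/
def mu (x y : PPerm) : ℤ :=
  if x = y then 1
  else if ¬ Le x y then 0
  else - ∑ z ∈ ((permsUpTo y.1).filter (fun z => Le x z ∧ Le z y ∧ z ≠ y)).attach,
      mu x z.1
termination_by y.1
decreasing_by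
  have hz := z.2
  rw [Finset.mem_filter] at hz
  obtain ⟨hmem, _, hzy, hne⟩ := hz
  have h1 : z.1.1 ≤ y.1 := size_le_of_mem_permsUpTo hmem
  rcases lt_or_eq_of_le h1 with h | h
  · exact h
  · exact absurd (hzy.eq_of_size_eq h) hne

/-- The closed interval `[x,y]` in the pattern-containment poset, as a finite set. -/
def Icc (x y : PPerm) : Finset PPerm :=
  (permsUpTo y.1).filter (fun z => Le x z ∧ Le z y)

/-- The half-open interval `[x,y)` in the pattern-containment poset, as a finite set. -/
def Ico (x y : PPerm) : Finset PPerm :=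
  (Icc x y).filter (fun z => z ≠ y)

/-- `E σ π` : the number of embeddings of `σ` into `π`. -/
def E (σ π : PPerm) : ℕ := Nat.card {f : Fin σ.1 → Fin π.1 // IsEmb σ π f}

/-- A normal embedding: an embedding whose image contains every non-initial position of
every adjacency of `π`. (A position `p` is a non-initial position of an adjacency of `π`
iff it has an immediate predecessor `q` with `π p = π q + 1`.) -/
def IsNormalEmb (σ π : PPerm) (f : Fin σ.1 → Fin π.1) : Prop :=
  IsEmb σ π f ∧
    ∀ p q : Fin π.1, (p : ℕ) = (q : ℕ) + 1 → ((π.2 p : ℕ) = (π.2 q : ℕ) + 1) →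
      p ∈ Set.range f

/-- `NE σ π` : the number of normal embeddings of `σ` into `π`. -/
def NE (σ π : PPerm) : ℕ := Nat.card {f : Fin σ.1 → Fin π.1 // IsNormalEmb σ π f}

/-- The number of inverse descents of `π`: pairs of positions `i < j` with
`π(i) = π(j) + 1`. -/
def ides (π : PPerm) : ℕ :=
  Nat.card {p : Fin π.1 × Fin π.1 // p.1 < p.2 ∧ ((π.2 p.1 : ℕ) = (π.2 p.2 : ℕ) + 1)}

/-- The unique permutation of size 1. -/
def one : PPerm := ⟨1, Equiv.refl _⟩

/-- The permutation `12`. -/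
def perm12 : PPerm := ⟨2, Equiv.refl _⟩

/-- The decreasing permutation `δ_k = k, k-1, …, 1`. -/
def delta (k : ℕ) : PPerm := ⟨k, Fin.revPerm⟩

/-- The permutation `21`. -/
def perm21 : PPerm := delta 2

/-- The value of `π_n` at the 1-indexed position `i ∈ [1, 2n+2]` (as a 1-indexed value):
`π_n = n+1, 1, n+3, 2, n+4, 3, …, n, 2n+2, n+2`. -/
def piVal (n i : ℕ) : ℕ :=
  if i = 1 then n + 1
  else if i = 2 * n + 2 then n + 2
  else if i % 2 = 0 then i / 2
  else n + 2 + i / 2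

/-- The 1-indexed position of the 1-indexed value `v` in `π_n`. -/
def piValInv (n v : ℕ) : ℕ :=
  if v = n + 1 then 1
  else if v = n + 2 then 2 * n + 2
  else if v ≤ n then 2 * v
  else 2 * (v - n - 2) + 1

/-- The permutation `π_n` as a permutation of `Fin (2n+2)` (0-indexed). -/
def piEquiv (n : ℕ) : Equiv.Perm (Fin (2 * n + 2)) where
  toFun p := ⟨piVal n (p.1 + 1) - 1, by
    have := p.2; unfold piVal; split_ifs <;> omega⟩
  invFun v := ⟨piValInv n (v.1 + 1) - 1, by
    have := v.2; unfold piValInv; split_ifs <;> omega⟩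
  left_inv p := by
    have := p.2
    apply Fin.ext
    show piValInv n (piVal n (p.1 + 1) - 1 + 1) - 1 = p.1
    unfold piVal piValInv
    split_ifs <;> omega
  right_inv v := by
    have := v.2
    apply Fin.ext
    show piVal n (piValInv n (v.1 + 1) - 1 + 1) - 1 = v.1
    unfold piVal piValInv
    split_ifs <;> omega

/-- `π_n` as an element of the permutation poset; it has size `2n+2`. -/
def piPerm (n : ℕ) : PPerm := ⟨2 * n + 2, piEquiv n⟩

/-- `p` is a top position of `π_n`: it carries one of the values `n+3, …, 2n+2`
(1-indexed), i.e. one of the 0-indexed values `n+2, …, 2n+1`. -/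
def piTopPos (n : ℕ) (p : Fin (2 * n + 2)) : Prop := n + 2 ≤ ((piEquiv n) p : ℕ)

/-- `p` is a bottom position of `π_n`: it carries one of the values `1, …, n`
(1-indexed), i.e. one of the 0-indexed values `0, …, n-1`. -/
def piBotPos (n : ℕ) (p : Fin (2 * n + 2)) : Prop := ((piEquiv n) p : ℕ) < n

/-- `k` is a top position of `lam`: for a permutation `lam` with a unique inverse
descent `(i,j)` this says `lam k ≥ lam i`. -/
def IsTopPos (lam : PPerm) (k : Fin lam.1) : Prop :=
  ∃ i j : Fin lam.1, i < j ∧ ((lam.2 i : ℕ) = (lam.2 j : ℕ) + 1) ∧ lam.2 i ≤ lam.2 k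

/-- `k` is a bottom position of `lam`: for a permutation `lam` with a unique inverse
descent `(i,j)` this says `lam k ≤ lam j`. -/
def IsBotPos (lam : PPerm) (k : Fin lam.1) : Prop :=
  ∃ i j : Fin lam.1, i < j ∧ ((lam.2 i : ℕ) = (lam.2 j : ℕ) + 1) ∧ lam.2 k ≤ lam.2 j

/-- A top repetition of `lam` at position `k`: positions `k` and `k+1` are both
top positions. -/
def IsTopRep (lam : PPerm) (k : Fin lam.1) : Prop :=
  ∃ h : (k : ℕ) + 1 < lam.1, IsTopPos lam k ∧ IsTopPos lam ⟨(k : ℕ) + 1, h⟩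

/-- A bottom repetition of `lam` at position `k`: positions `k` and `k+1` are both
bottom positions. -/
def IsBotRep (lam : PPerm) (k : Fin lam.1) : Prop :=
  ∃ h : (k : ℕ) + 1 < lam.1, IsBotPos lam k ∧ IsBotPos lam ⟨(k : ℕ) + 1, h⟩

/-- `lam` is a proper permutation with respect to `π_n`. -/
def IsProper (n : ℕ) (lam : PPerm) : Prop :=
  Le perm21 lam ∧ Le lam (piPerm n) ∧ lam ≠ piPerm n ∧
  ides lam = 1 ∧
  (∀ k : Fin lam.1, (k : ℕ) = 0 → IsTopPos lam k) ∧
  (∀ k : Fin lam.1, (k : ℕ) = 1 → IsBotPos lam k) ∧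
  (∀ k : Fin lam.1, (k : ℕ) = lam.1 - 2 → IsTopPos lam k) ∧
  (∀ k : Fin lam.1, (k : ℕ) = lam.1 - 1 → IsBotPos lam k) ∧
  Nat.card {k : Fin lam.1 // IsTopRep lam k} ≤ 1 ∧
  Nat.card {k : Fin lam.1 // IsBotRep lam k} ≤ 1 ∧
  (∀ k l : Fin lam.1, IsTopRep lam k → IsBotRep lam l → k < l)

/-- `S_lam = ∑_{τ ∈ [lam, π_n]} (-1)^{|τ|} E(τ, π_n)`. -/
def Svals (n : ℕ) (lam : PPerm) : ℤ :=
  ∑ τ ∈ Icc lam (piPerm n), (-1 : ℤ) ^ τ.1 * (E τ (piPerm n) : ℤ)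

/-- `lam` is vanishing (with respect to `π_n`): `μ(21, lam) · S_lam = 0`. -/
def Vanishing (n : ℕ) (lam : PPerm) : Prop := mu perm21 lam * Svals n lam = 0

/-- The reverse-complement of a permutation. -/
def rc (lam : PPerm) : PPerm := ⟨lam.1, (Fin.revPerm.trans lam.2).trans Fin.revPerm⟩

/-- The cup of size `m`: the permutation `(m-1), 1, 2, …, (m-2), m`. -/
def IsCup (lam : PPerm) : Prop :=
  ∀ k : Fin lam.1, (lam.2 k : ℕ) =
    if (k : ℕ) = 0 then lam.1 - 2 else if (k : ℕ) = lam.1 - 1 then lam.1 - 1 else (k : ℕ) - 1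

/-- The cap of size `m`: the permutation `1, 3, 4, …, m, 2`. -/
def IsCap (lam : PPerm) : Prop :=
  ∀ k : Fin lam.1, (lam.2 k : ℕ) =
    if (k : ℕ) = 0 then 0 else if (k : ℕ) = lam.1 - 1 then 1 else (k : ℕ) + 1

/-- `LexLt f f'` : `f` is lexicographically smaller than `f'`, i.e. `f i < f' i` at the
smallest index `i` where they differ. -/
def LexLt {m N : ℕ} (f f' : Fin m → Fin N) : Prop :=
  ∃ i : Fin m, f i < f' i ∧ ∀ j : Fin m, j < i → f j = f' j

/-- `f` is the rightmost (lexicographically greatest) embedding of `lam` into `π_n`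
with image contained in `T`. -/
def IsRightmostIn (n : ℕ) (lam : PPerm) (f : Fin lam.1 → Fin (2 * n + 2))
    (T : Finset (Fin (2 * n + 2))) : Prop :=
  IsEmb lam (piPerm n) f ∧ (∀ i, f i ∈ T) ∧
    ∀ f' : Fin lam.1 → Fin (2 * n + 2), IsEmb lam (piPerm n) f' → (∀ i, f' i ∈ T) →
      f' ≠ f → LexLt f' f

/-- `S_f = ∑_g (-1)^{|g|}`, the sum over all embeddings `g` into `π_n` (of permutations
`τ` with `lam ≤ τ ≤ π_n`) such that `f` is the rightmost embedding of `lam` compatible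
with `g`. Embeddings into `π_n` are identified with their images, which are subsets of
`Fin (2n+2)`. -/
def Sf (n : ℕ) (lam : PPerm) (f : Fin lam.1 → Fin (2 * n + 2)) : ℤ :=
  ∑ T ∈ Finset.univ.filter (fun T : Finset (Fin (2 * n + 2)) => IsRightmostIn n lam f T),
    (-1 : ℤ) ^ T.card

/-- `f` is greedy in a set `S` of positions of `π_n` (for a proper permutation `lam`):
the last element of `lam` goes to the largest bottom-or-right position of `S`, every other
top element of `lam` goes to the largest left-or-top position of `S` below the image of
the next element, and every other bottom element of `lam` goes to the largest bottom
position of `S` below the image of the next element. -/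
def IsGreedyIn (n : ℕ) (lam : PPerm) (S : Set (Fin (2 * n + 2)))
    (f : Fin lam.1 → Fin (2 * n + 2)) : Prop :=
  (∀ i : Fin lam.1, (i : ℕ) = lam.1 - 1 →
    IsGreatest {p : Fin (2 * n + 2) | p ∈ S ∧ (piBotPos n p ∨ (p : ℕ) = 2 * n + 1)} (f i)) ∧
  (∀ (i : Fin lam.1) (hi : (i : ℕ) + 1 < lam.1), IsTopPos lam i →
    IsGreatest {p : Fin (2 * n + 2) |
      p ∈ S ∧ ((p : ℕ) = 0 ∨ piTopPos n p) ∧ p < f ⟨(i : ℕ) + 1, hi⟩} (f i)) ∧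
  (∀ (i : Fin lam.1) (hi : (i : ℕ) + 1 < lam.1), IsBotPos lam i →
    IsGreatest {p : Fin (2 * n + 2) |
      p ∈ S ∧ piBotPos n p ∧ p < f ⟨(i : ℕ) + 1, hi⟩} (f i))

/-- `f` is almost greedy in `S`: `S` contains the rightmost position of `π_n` and `f` is
greedy in `S` with the rightmost position removed. -/
def IsAlmostGreedyIn (n : ℕ) (lam : PPerm) (S : Set (Fin (2 * n + 2)))
    (f : Fin lam.1 → Fin (2 * n + 2)) : Prop :=
  Fin.last (2 * n + 1) ∈ S ∧ IsGreedyIn n lam (S \ {Fin.last (2 * n + 1)}) f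

/-- The value of Smith's permutation `n+1, 1, n+2, 2, …, 2n, n` at the 1-indexed
position `i ∈ [1, 2n]`, as a 1-indexed value: `π(2i-1) = n+i` and `π(2i) = i`. -/
def sVal (n i : ℕ) : ℕ := if i % 2 = 1 then n + (i + 1) / 2 else i / 2

/-- The 1-indexed position of the 1-indexed value `v` in Smith's permutation. -/
def sValInv (n v : ℕ) : ℕ := if v ≤ n then 2 * v else 2 * (v - n) - 1

/-- Smith's permutation `n+1, 1, n+2, 2, …, 2n, n` as a permutation of `Fin (2n)`. -/
def sEquiv (n : ℕ) : Equiv.Perm (Fin (2 * n)) where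
  toFun p := ⟨sVal n (p.1 + 1) - 1, by have := p.2; unfold sVal; split_ifs <;> omega⟩
  invFun v := ⟨sValInv n (v.1 + 1) - 1, by have := v.2; unfold sValInv; split_ifs <;> omega⟩
  left_inv p := by
    have := p.2
    apply Fin.ext
    show sValInv n (sVal n (p.1 + 1) - 1 + 1) - 1 = p.1
    unfold sVal sValInv
    split_ifs <;> omega
  right_inv v := by
    have := v.2
    apply Fin.ext
    show sVal n (sValInv n (v.1 + 1) - 1 + 1) - 1 = v.1
    unfold sVal sValInv
    split_ifs <;> omega

/-- Smith's permutation as an element of the permutation poset; it has size `2n`. -/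
def smithPerm (n : ℕ) : PPerm := ⟨2 * n, sEquiv n⟩

lemma Le.refl (σ : PPerm) : Le σ σ := ⟨id, strictMono_id, fun _ _ => Iff.rfl⟩

lemma Le.trans {σ τ π : PPerm} (h : Le σ τ) (h' : Le τ π) : Le σ π := by
  obtain ⟨f, hf, hf'⟩ := h
  obtain ⟨g, hg, hg'⟩ := h'
  exact ⟨g ∘ f, hg.comp hf, fun i j => (hf' i j).trans (hg' _ _)⟩

lemma mem_permsUpTo {N : ℕ} {z : PPerm} : z ∈ permsUpTo N ↔ z.1 ≤ N := by
  refine ⟨size_le_of_mem_permsUpTo, fun h => ?_⟩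
  obtain ⟨k, p⟩ := z
  simp only [permsUpTo, permsOfSize, Finset.mem_biUnion, Finset.mem_range,
    Finset.mem_image, Finset.mem_univ, true_and]
  exact ⟨k, Nat.lt_succ_of_le h, p, rfl⟩

/-- The permutations strictly contained in `π`, as a finite set. -/
def below (π : PPerm) : Finset PPerm :=
  (permsUpTo π.1).filter (fun z => Le z π ∧ z ≠ π)

lemma mem_below {z π : PPerm} : z ∈ below π ↔ Le z π ∧ z ≠ π := by
  simp only [below, Finset.mem_filter, mem_permsUpTo]
  exact ⟨fun h => h.2, fun h => ⟨h.1.size_le, h⟩⟩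

lemma size_lt_of_mem_below {z π : PPerm} (h : z ∈ below π) : z.1 < π.1 := by
  rw [mem_below] at h
  exact lt_of_le_of_ne h.1.size_le fun hs => h.2 (h.1.eq_of_size_eq hs)

lemma mu_eq_zero_of_not_le {x y : PPerm} (h : ¬ Le x y) : mu x y = 0 := by
  have hne : x ≠ y := by
    rintro rfl
    exact h (Le.refl x)
  rw [mu, if_neg hne, if_pos h]

/-- The recursion for `mu`, with the sum taken over the whole strict down-set of `y`. -/
lemma mu_eq_sub_sum_below (x y : PPerm) :
    mu x y = (if x = y then 1 else 0) - ∑ z ∈ below y, mu x z := by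
  by_cases hxy : x = y
  · subst hxy
    have hz : ∑ z ∈ below x, mu x z = 0 := by
      refine Finset.sum_eq_zero fun z hz => mu_eq_zero_of_not_le fun hle => ?_
      exact absurd hle.size_le (not_le.mpr (size_lt_of_mem_below hz))
    rw [hz, mu]
    simp
  · by_cases hle : Le x y
    · rw [mu, if_neg hxy, if_neg (not_not.mpr hle), if_neg hxy, zero_sub,
        Finset.sum_attach _ (fun z => mu x z)]
      congr 1
      refine Finset.sum_subset ?_ ?_
      · intro z hz
        exact mem_below.mpr (Finset.mem_filter.mp hz).2.2
      · intro z hz hz'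
        refine mu_eq_zero_of_not_le fun hxz => hz' ?_
        exact Finset.mem_filter.mpr
          ⟨mem_permsUpTo.mpr (size_lt_of_mem_below hz).le, hxz, mem_below.mp hz⟩
    · have hz : ∑ z ∈ below y, mu x z = 0 :=
        Finset.sum_eq_zero fun z hz =>
          mu_eq_zero_of_not_le fun hxz => hle (hxz.trans (mem_below.mp hz).1)
      rw [hz, mu_eq_zero_of_not_le hle, if_neg hxy, sub_zero]

lemma one_le_iff {π : PPerm} : Le one π ↔ 1 ≤ π.1 := by
  refine ⟨fun h => h.size_le, fun h => ?_⟩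
  have : Subsingleton (Fin one.1) := inferInstanceAs (Subsingleton (Fin 1))
  refine ⟨fun _ => ⟨0, h⟩, Subsingleton.strictMono _, fun i j => ?_⟩
  rw [Subsingleton.elim i j]
  simp

/-- The only permutations avoiding `12` are the decreasing ones. -/
lemma perm12_le_iff {π : PPerm} : Le perm12 π ↔ π ≠ delta π.1 := by
  constructor
  · rintro ⟨f, hf, hpat⟩ he
    have key : ∀ i j, i < j → π.2 j < π.2 i := by
      obtain ⟨n, p⟩ := π
      obtain rfl : p = Fin.revPerm := by simpa [delta] using he
      intro i j hij
      simpa using hij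
    have h01 : (0 : Fin 2) < 1 := by decide
    exact lt_asymm (key _ _ (hf h01)) ((hpat (0 : Fin 2) (1 : Fin 2)).mp h01)
  · intro hne
    by_contra hle
    refine hne ?_
    obtain ⟨n, p⟩ := π
    have key : ∀ i j, i < j → p j < p i := by
      intro i j hij
      by_contra hlt
      have hlt' : p i < p j :=
        lt_of_le_of_ne (not_lt.mp hlt) fun h => hij.ne (p.injective h)
      have hmono : StrictMono (![i, j] : Fin 2 → Fin n) := by
        rw [Fin.strictMono_iff_lt_succ]
        intro k
        fin_cases k
        simpa using hij
      refine hle ⟨(![i, j] : Fin 2 → Fin n), hmono, ?_⟩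
      have h01 : (0 : Fin 2) < 1 := by decide
      show ∀ a b : Fin 2, a < b ↔ p (![i, j] a) < p (![i, j] b)
      intro a b
      fin_cases a <;> fin_cases b <;> simp [hlt', hlt'.le]
    have hid : (fun i => Fin.rev (p i)) = id :=
      strictMono_fin_eq_id fun i j hij => Fin.rev_lt_rev.mpr (key i j hij)
    have hp : p = Fin.revPerm := by
      ext1 i
      have := congrFun hid i
      simp only [id] at this
      rw [Fin.revPerm_apply, ← Fin.rev_rev (p i), this]
    rw [hp]
    rfl

lemma sum_delta_indicator {N : ℕ} {π : PPerm} (h : π.1 ≤ N) :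
    ∑ k ∈ Finset.Icc 1 N, (if delta k = π then (1 : ℤ) else 0) =
      if 1 ≤ π.1 ∧ π = delta π.1 then 1 else 0 := by
  have hk : ∀ k, delta k = π ↔ π.1 = k ∧ π = delta π.1 := by
    intro k
    constructor
    · rintro rfl
      exact ⟨rfl, rfl⟩
    · rintro ⟨rfl, he⟩
      exact he.symm
  simp only [hk]
  by_cases he : π = delta π.1
  · simp only [← he, and_true, Finset.sum_ite_eq, Finset.mem_Icc, h]
  · simp [he]

/-- The sum `∑ μ(δ_k, π)`, with any upper limit at least `|π|`, is the indicator of `1` minus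
the indicator of `12`. -/
lemma sum_mu_delta_eq {N : ℕ} (π : PPerm) (h : π.1 ≤ N) :
    ∑ k ∈ Finset.Icc 1 N, mu (delta k) π =
      (if one = π then 1 else 0) - (if perm12 = π then 1 else 0) := by
  have ih : ∀ z ∈ below π, ∑ k ∈ Finset.Icc 1 N, mu (delta k) z =
      (if one = z then 1 else 0) - (if perm12 = z then 1 else 0) := fun z hz =>
    have := size_lt_of_mem_below hz
    sum_mu_delta_eq z (this.le.trans h)
  simp_rw [mu_eq_sub_sum_below _ π]
  rw [Finset.sum_sub_distrib, sum_delta_indicator h, Finset.sum_comm, Finset.sum_congr rfl ih,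
    Finset.sum_sub_distrib, Finset.sum_ite_eq, Finset.sum_ite_eq]
  simp only [mem_below, one_le_iff, perm12_le_iff]
  have h1 : one = π → 1 ≤ π.1 ∧ π = delta π.1 := by
    rintro rfl
    exact ⟨le_rfl, not_not.mp fun hne => absurd (perm12_le_iff.mpr hne).size_le (by decide)⟩
  have h2 : perm12 = π → 1 ≤ π.1 ∧ π ≠ delta π.1 := by
    rintro rfl
    exact ⟨by decide, perm12_le_iff.mp (Le.refl _)⟩
  have h3 : π ≠ delta π.1 → 1 ≤ π.1 := fun hne =>
    le_trans (by decide) (perm12_le_iff.mpr hne).size_le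
  have h4 : one = π → perm12 ≠ π := by
    rintro h rfl
    exact absurd (congrArg Sigma.fst h) (by decide)
  clear ih
  simp only [ne_eq]
  split_ifs <;> first | rfl | (exfalso; tauto)
termination_by π.1

/-- For any permutation `π` other than `1` and `12`,
`∑_{k=1}^{|π|} μ(δ_k, π) = 0`. -/
theorem sum_mu_delta (π : PPerm) (hpos : 1 ≤ π.1) (h1 : π ≠ one) (h2 : π ≠ perm12) :
    ∑ k ∈ Finset.Icc 1 π.1, mu (delta k) π = 0 := by
  rw [sum_mu_delta_eq π le_rfl, if_neg h1.symm, if_neg h2.symm, sub_zero]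

end PPerm

end
end

section
/- Let n ≥ 2 and let λ be a proper permutation of size m (with respect to π_n). Let λ^rc denote the reverse-complement of λ, defined by λ^rc(i) = m+1−λ(m+1−i). Then λ^rc is proper, μ(21,λ) = μ(21,λ^rc), and S_λ = S_{λ^rc}, where S_λ = ∑_{τ: λ≤τ≤π_n} (−1)^{|τ|}·E(τ,π_n). -/
open scoped Classical

noncomputable section

namespace PPerm

@[simp] lemma rc_apply (lam : PPerm) (i : Fin lam.1) :
    (rc lam).2 i = Fin.rev (lam.2 (Fin.rev i)) := rfl

@[simp] lemma rc_rc (lam : PPerm) : rc (rc lam) = lam := by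
  refine Sigma.ext rfl (heq_of_eq (Equiv.ext fun (i : Fin lam.1) => ?_))
  change Fin.rev (Fin.rev (lam.2 (Fin.rev (Fin.rev i)))) = lam.2 i
  simp only [Fin.rev_rev]

lemma rc_injective : Function.Injective rc :=
  Function.LeftInverse.injective rc_rc

lemma rc_perm21 : rc perm21 = perm21 := by
  refine Sigma.ext rfl (heq_of_eq (Equiv.ext fun i => ?_))
  change Fin.rev (Fin.rev (Fin.rev i)) = Fin.rev i
  rw [Fin.rev_rev]

lemma rc_piPerm (n : ℕ) : rc (piPerm n) = piPerm n := by
  refine Sigma.ext rfl (heq_of_eq (Equiv.ext fun (p : Fin (2 * n + 2)) => Fin.ext ?_))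
  have hp := p.2
  change 2 * n + 2 - ((piVal n ((2 * n + 2 - (p.1 + 1)) + 1) - 1) + 1) = piVal n (p.1 + 1) - 1
  unfold piVal
  split_ifs <;> omega

lemma IsEmb.rc {σ π : PPerm} {f : Fin σ.1 → Fin π.1} (hf : IsEmb σ π f) :
    IsEmb (rc σ) (rc π) (fun i : Fin σ.1 => Fin.rev (f (Fin.rev i))) := by
  constructor
  · intro (i : Fin σ.1) (j : Fin σ.1) hij
    exact Fin.rev_lt_rev.2 (hf.1 (Fin.rev_lt_rev.2 hij))
  · intro (i : Fin σ.1) (j : Fin σ.1)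
    change Fin.rev (σ.2 (Fin.rev i)) < Fin.rev (σ.2 (Fin.rev j)) ↔
      Fin.rev (π.2 (Fin.rev (Fin.rev (f (Fin.rev i))))) <
        Fin.rev (π.2 (Fin.rev (Fin.rev (f (Fin.rev j)))))
    simp only [Fin.rev_rev, Fin.rev_lt_rev]
    exact hf.2 _ _

lemma Le.rc {σ π : PPerm} (h : Le σ π) : Le (rc σ) (rc π) :=
  let ⟨_, hf⟩ := h
  ⟨_, hf.rc⟩

lemma le_rc_iff {σ π : PPerm} : Le (rc σ) (rc π) ↔ Le σ π :=
  ⟨fun h => by simpa using h.rc, Le.rc⟩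

lemma E_rc (σ π : PPerm) : E (rc σ) (rc π) = E σ π := by
  have key : ∀ σ π : PPerm, E σ π ≤ E (rc σ) (rc π) := fun σ π => by
    refine Nat.card_le_card_of_injective
      (fun f : {f : Fin σ.1 → Fin π.1 // IsEmb σ π f} =>
        (⟨_, f.2.rc⟩ : {f : Fin (rc σ).1 → Fin (rc π).1 // IsEmb (rc σ) (rc π) f})) ?_
    intro f g hfg
    refine Subtype.ext (funext fun i => ?_)
    have h : Fin.rev (f.1 (Fin.rev (Fin.rev i))) = Fin.rev (g.1 (Fin.rev (Fin.rev i))) :=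
      congrFun (congrArg Subtype.val hfg) (Fin.rev i)
    simpa only [Fin.rev_rev, Fin.rev_inj] using h
  exact le_antisymm (by simpa using key (rc σ) (rc π)) (key σ π)

lemma mem_Icc {x y z : PPerm} : z ∈ Icc x y ↔ Le x z ∧ Le z y := by
  simp only [Icc, Finset.mem_filter, mem_permsUpTo, and_iff_right_iff_imp]
  exact fun h => h.2.size_le

lemma mem_Ico {x y z : PPerm} : z ∈ Ico x y ↔ (Le x z ∧ Le z y) ∧ z ≠ y := by
  simp only [Ico, Finset.mem_filter, mem_Icc]

lemma rc_mem_Icc {x y z : PPerm} : rc z ∈ Icc (rc x) (rc y) ↔ z ∈ Icc x y := by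
  simp only [mem_Icc, le_rc_iff]

lemma rc_mem_Ico {x y z : PPerm} : rc z ∈ Ico (rc x) (rc y) ↔ z ∈ Ico x y := by
  simp only [mem_Ico, le_rc_iff, rc_injective.ne_iff]

lemma size_lt_of_mem_Ico {x y z : PPerm} (h : z ∈ Ico x y) : z.1 < y.1 := by
  obtain ⟨⟨-, hzy⟩, hne⟩ := mem_Ico.1 h
  exact lt_of_le_of_ne hzy.size_le fun hs => hne (hzy.eq_of_size_eq hs)

lemma mu_eq (x y : PPerm) :
    mu x y = if x = y then 1 else if ¬ Le x y then 0 else - ∑ z ∈ Ico x y, mu x z := by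
  rw [mu, Finset.sum_attach _ (fun z => mu x z)]
  congr 4
  ext z
  simp only [Ico, Icc, Finset.mem_filter, and_assoc]

lemma mu_rc (x y : PPerm) : mu (rc x) (rc y) = mu x y := by
  induction hN : y.1 using Nat.strong_induction_on generalizing y with
  | _ N ih =>
    subst hN
    rw [mu_eq, mu_eq x y]
    simp only [rc_injective.eq_iff, le_rc_iff]
    congr 3
    refine (Finset.sum_bij (fun z _ => rc z) (fun z hz => rc_mem_Ico.2 hz)
      (fun _ _ _ _ h => rc_injective h) (fun z hz => ⟨rc z, ?_, rc_rc z⟩) ?_).symm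
    · rwa [← rc_mem_Ico, rc_rc]
    · exact fun z hz => (ih z.1 (size_lt_of_mem_Ico hz) z rfl).symm

lemma Svals_rc (n : ℕ) (lam : PPerm) : Svals n (rc lam) = Svals n lam := by
  have hmem (z : PPerm) : rc z ∈ Icc (rc lam) (piPerm n) ↔ z ∈ Icc lam (piPerm n) := by
    conv_lhs => rw [← rc_piPerm n]
    exact rc_mem_Icc
  refine (Finset.sum_bij (fun z _ => rc z) (fun z hz => (hmem z).2 hz)
    (fun _ _ _ _ h => rc_injective h) (fun z hz => ⟨rc z, ?_, rc_rc z⟩) fun z _ => ?_).symm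
  · rwa [← hmem, rc_rc]
  · conv_rhs => rw [← rc_piPerm n, E_rc]
    rfl

/-- Reverse-complementation maps the inverse descent `(i, j)` to `(rev j, rev i)`. -/
lemma inverseDescent_rc_iff (lam : PPerm) {i j : Fin lam.1} :
    (i < j ∧ ((rc lam).2 i : ℕ) = ((rc lam).2 j : ℕ) + 1) ↔
      Fin.rev j < Fin.rev i ∧ (lam.2 (Fin.rev j) : ℕ) = (lam.2 (Fin.rev i) : ℕ) + 1 := by
  have hi := (lam.2 (Fin.rev i)).2
  have hj := (lam.2 (Fin.rev j)).2
  simp only [rc_apply, Fin.rev_lt_rev, Fin.val_rev]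
  refine and_congr_right fun _ => ?_
  omega

lemma ides_rc (lam : PPerm) : ides (rc lam) = ides lam :=
  Nat.card_congr (Equiv.subtypeEquiv
    ((Equiv.prodComm (Fin lam.1) (Fin lam.1)).trans (Fin.revPerm.prodCongr Fin.revPerm))
    fun p => inverseDescent_rc_iff lam (i := p.1) (j := p.2))

lemma isTopPos_rc_iff {lam : PPerm} {k : Fin lam.1} :
    IsTopPos (rc lam) k ↔ IsBotPos lam (Fin.rev k) := by
  constructor
  · rintro ⟨i, j, hij, hd, hk⟩
    obtain ⟨hij', hd'⟩ := (inverseDescent_rc_iff lam).1 ⟨hij, hd⟩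
    exact ⟨_, _, hij', hd', Fin.rev_le_rev.1 hk⟩
  · rintro ⟨i, j, hij, hd, hk⟩
    obtain ⟨hij', hd'⟩ := (inverseDescent_rc_iff lam (i := Fin.rev j) (j := Fin.rev i)).2
      (by simpa only [Fin.rev_rev] using And.intro hij hd)
    refine ⟨_, _, hij', hd', Fin.rev_le_rev.2 ?_⟩
    change lam.2 (Fin.rev k) ≤ lam.2 (Fin.rev (Fin.rev j))
    rwa [Fin.rev_rev]

lemma isBotPos_rc_iff {lam : PPerm} {k : Fin lam.1} :
    IsBotPos (rc lam) k ↔ IsTopPos lam (Fin.rev k) := by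
  constructor
  · rintro ⟨i, j, hij, hd, hk⟩
    obtain ⟨hij', hd'⟩ := (inverseDescent_rc_iff lam).1 ⟨hij, hd⟩
    exact ⟨_, _, hij', hd', Fin.rev_le_rev.1 hk⟩
  · rintro ⟨i, j, hij, hd, hk⟩
    obtain ⟨hij', hd'⟩ := (inverseDescent_rc_iff lam (i := Fin.rev j) (j := Fin.rev i)).2
      (by simpa only [Fin.rev_rev] using And.intro hij hd)
    refine ⟨_, _, hij', hd', Fin.rev_le_rev.2 ?_⟩
    change lam.2 (Fin.rev (Fin.rev i)) ≤ lam.2 (Fin.rev k)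
    rwa [Fin.rev_rev]

lemma IsTopRep.of_rc {lam : PPerm} {k : Fin lam.1} (h : IsTopRep (rc lam) k) :
    ∃ l : Fin lam.1, (l : ℕ) + k + 2 = lam.1 ∧ IsBotRep lam l := by
  obtain ⟨hk : (k : ℕ) + 1 < lam.1, h₁, h₂⟩ := h
  refine ⟨Fin.rev ⟨(k : ℕ) + 1, hk⟩, ?_, ?_, isTopPos_rc_iff.1 h₂, ?_⟩
  · rw [Fin.val_rev]
    dsimp only
    omega
  · rw [Fin.val_rev]
    dsimp only
    omega
  · convert isTopPos_rc_iff.1 h₁ using 1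
    ext
    simp only [Fin.val_rev]
    omega

lemma IsBotRep.of_rc {lam : PPerm} {k : Fin lam.1} (h : IsBotRep (rc lam) k) :
    ∃ l : Fin lam.1, (l : ℕ) + k + 2 = lam.1 ∧ IsTopRep lam l := by
  obtain ⟨hk : (k : ℕ) + 1 < lam.1, h₁, h₂⟩ := h
  refine ⟨Fin.rev ⟨(k : ℕ) + 1, hk⟩, ?_, ?_, isBotPos_rc_iff.1 h₂, ?_⟩
  · rw [Fin.val_rev]
    dsimp only
    omega
  · rw [Fin.val_rev]
    dsimp only
    omega
  · convert isBotPos_rc_iff.1 h₁ using 1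
    ext
    simp only [Fin.val_rev]
    omega

lemma IsProper.rc {n : ℕ} {lam : PPerm} (h : IsProper n lam) : IsProper n (rc lam) := by
  obtain ⟨h21, hpi, hne, hides, h0, h1, hm2, hm1, htop, hbot, hlt⟩ := h
  have hm : 2 ≤ lam.1 := h21.size_le
  rw [Finite.card_le_one_iff_subsingleton, subsingleton_iff] at htop hbot
  refine ⟨?_, ?_, ?_, ?_, ?_, ?_, ?_, ?_, ?_, ?_, ?_⟩
  · simpa only [rc_perm21] using h21.rc
  · simpa only [rc_piPerm] using hpi.rc
  · intro he
    exact hne (rc_injective (he.trans (rc_piPerm n).symm))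
  · rw [ides_rc, hides]
  · intro (k : Fin lam.1) hk
    exact isTopPos_rc_iff.2 (hm1 _ (by rw [Fin.val_rev]; omega))
  · intro (k : Fin lam.1) hk
    exact isBotPos_rc_iff.2 (hm2 _ (by rw [Fin.val_rev]; omega))
  · intro (k : Fin lam.1) (hk : (k : ℕ) = lam.1 - 2)
    exact isTopPos_rc_iff.2 (h1 _ (by rw [Fin.val_rev]; omega))
  · intro (k : Fin lam.1) (hk : (k : ℕ) = lam.1 - 1)
    exact isBotPos_rc_iff.2 (h0 _ (by rw [Fin.val_rev]; omega))
  · rw [Finite.card_le_one_iff_subsingleton, subsingleton_iff]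
    rintro ⟨k, hk⟩ ⟨k', hk'⟩
    obtain ⟨l, hl, hr⟩ := IsTopRep.of_rc hk
    obtain ⟨l', hl', hr'⟩ := IsTopRep.of_rc hk'
    have he : (l : ℕ) = l' := congrArg (fun z => (z.1 : ℕ)) (hbot ⟨l, hr⟩ ⟨l', hr'⟩)
    exact Subtype.ext (Fin.ext (by dsimp only; omega))
  · rw [Finite.card_le_one_iff_subsingleton, subsingleton_iff]
    rintro ⟨k, hk⟩ ⟨k', hk'⟩
    obtain ⟨l, hl, hr⟩ := IsBotRep.of_rc hk
    obtain ⟨l', hl', hr'⟩ := IsBotRep.of_rc hk'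
    have he : (l : ℕ) = l' := congrArg (fun z => (z.1 : ℕ)) (htop ⟨l, hr⟩ ⟨l', hr'⟩)
    exact Subtype.ext (Fin.ext (by dsimp only; omega))
  · intro k l hk hl
    obtain ⟨k', hk', hbr⟩ := IsTopRep.of_rc hk
    obtain ⟨l', hl', htr⟩ := IsBotRep.of_rc hl
    have hlt' : (l' : ℕ) < k' := hlt l' k' htr hbr
    exact Fin.lt_def.2 (by omega)

/-- For `n ≥ 2` and a proper permutation `λ`, the reverse-complement
`λ^rc` is proper, `μ(21,λ) = μ(21,λ^rc)`, and `S_λ = S_{λ^rc}`. -/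
theorem proper_rc (n : ℕ) (hn : 2 ≤ n) (lam : PPerm) (h : IsProper n lam) :
    IsProper n (rc lam) ∧ mu perm21 lam = mu perm21 (rc lam) ∧
      Svals n lam = Svals n (rc lam) := by
  refine ⟨h.rc, ?_, (Svals_rc n lam).symm⟩
  rw [← mu_rc perm21 lam, rc_perm21]

end PPerm

end
end

section
/- Let n ≥ 2 and let f and f′ be two embeddings of a proper permutation λ of size m (with respect to π_n) into π_n. Then the function f* : [m] → [2n+2] defined by f*(i) = max{f(i), f′(i)} is also an embedding of λ into π_n. -/
open scoped Classical

noncomputable section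

namespace PPerm

/-- Values of `π_n` increase along the even positions and along the odd positions, and the value
at an odd position is below the value at an even position, except for the two end positions. -/
lemma piEquiv_lt_iff (n : ℕ) (p q : Fin (2 * n + 2)) :
    piEquiv n p < piEquiv n q ↔
      ((p : ℕ) % 2 = (q : ℕ) % 2 ∧ (p : ℕ) < q) ∨
      ((p : ℕ) % 2 = 1 ∧ (q : ℕ) % 2 = 0 ∧ ¬ ((p : ℕ) = 2 * n + 1 ∧ (q : ℕ) = 0)) ∨
      ((p : ℕ) = 0 ∧ (q : ℕ) = 2 * n + 1) := by
  have hp := p.2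
  have hq := q.2
  change piVal n (p.1 + 1) - 1 < piVal n (q.1 + 1) - 1 ↔ _
  unfold piVal
  split_ifs <;> omega

lemma unique_inverse_descent {lam : PPerm} (h : ides lam = 1) {i j i' j' : Fin lam.1}
    (hij : i < j) (hv : (lam.2 i : ℕ) = (lam.2 j : ℕ) + 1)
    (hij' : i' < j') (hv' : (lam.2 i' : ℕ) = (lam.2 j' : ℕ) + 1) : i = i' ∧ j = j' := by
  have hs := (Nat.card_eq_one_iff_unique.mp h).1
  have := congrArg Subtype.val
    (hs.elim ⟨(i, j), hij, hv⟩ ⟨(i', j'), hij', hv'⟩)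
  simpa using this

/-- A permutation with an inverse descent `(i, j)` whose first element is a top element and whose
last element is a bottom element embeds into `π_n` only by sending its top elements to even
positions and its bottom elements to odd positions. -/
lemma IsEmb.even_iff_top {n : ℕ} {lam : PPerm} {i j : Fin lam.1} (hij : i < j)
    (hv : (lam.2 i : ℕ) = (lam.2 j : ℕ) + 1)
    (hfirst : ∀ k : Fin lam.1, (k : ℕ) = 0 → lam.2 i ≤ lam.2 k)
    (hlast : ∀ k : Fin lam.1, (k : ℕ) = lam.1 - 1 → lam.2 k ≤ lam.2 j)
    {f : Fin lam.1 → Fin (2 * n + 2)} (hf : IsEmb lam (piPerm n) f) (k : Fin lam.1) :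
    (f k : ℕ) % 2 = 0 ↔ lam.2 i ≤ lam.2 k := by
  obtain ⟨hmono, hpat⟩ := hf
  have hpat : ∀ x y, lam.2 x < lam.2 y ↔ piEquiv n (f x) < piEquiv n (f y) := hpat
  have hm (x y : Fin lam.1) : (f x : ℕ) < f y ↔ (x : ℕ) < y := hmono.lt_iff_lt
  have hji := (piEquiv_lt_iff n _ _).mp ((hpat j i).mp (Fin.lt_def.mpr (by omega)))
  have hfij := (hm i j).mpr hij
  have hk := k.2
  have hfk := (f k).2
  constructor
  · intro hev
    by_contra! hlt
    have hkj : lam.2 k ≤ lam.2 j := by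
      rw [Fin.lt_def] at hlt; rw [Fin.le_def]; omega
    have hkj' : k = j ∨ lam.2 k < lam.2 j := by
      rcases hkj.eq_or_lt with h | h
      · exact Or.inl (lam.2.injective h)
      · exact Or.inr h
    rcases hkj' with rfl | h
    · omega
    · have h1 := (piEquiv_lt_iff n _ _).mp ((hpat _ _).mp h)
      have h2 : ¬ (k : ℕ) = 0 := fun h0 => (hfirst k h0).not_gt hlt
      have h3 := hm ⟨0, by omega⟩ k
      simp only at h3
      omega
  · intro hle
    by_contra hodd
    rcases hle.eq_or_lt with h | h
    · have := lam.2.injective h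
      subst this
      omega
    · have h1 := (piEquiv_lt_iff n _ _).mp ((hpat _ _).mp h)
      have h2 : ¬ (k : ℕ) = lam.1 - 1 := fun h0 => by
        have := hlast k h0
        rw [Fin.le_def] at this hle
        omega
      have h3 := hm k ⟨lam.1 - 1, by omega⟩
      have h4 := (f ⟨lam.1 - 1, by omega⟩).2
      simp only at h3
      omega

/-- For `n ≥ 2`, the pointwise maximum of two embeddings of a proper
permutation `λ` into `π_n` is again an embedding of `λ` into `π_n`. -/
theorem pointwise_max_isEmb (n : ℕ) (hn : 2 ≤ n) (lam : PPerm) (h : IsProper n lam)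
    (f f' : Fin lam.1 → Fin (2 * n + 2))
    (hf : IsEmb lam (piPerm n) f) (hf' : IsEmb lam (piPerm n) f') :
    IsEmb lam (piPerm n) (fun i => max (f i) (f' i)) := by
  obtain ⟨-, -, -, hides, h0, -, -, hlast, -⟩ := h
  have main : ∀ x y : Fin lam.1, lam.2 x < lam.2 y →
      piEquiv n (max (f x) (f' x)) < piEquiv n (max (f y) (f' y)) := by
    intro x y hxy
    have hx := x.2
    obtain ⟨i, j, hij, hv, hi⟩ := h0 ⟨0, by omega⟩ rfl
    have hF : ∀ k : Fin lam.1, (k : ℕ) = 0 → lam.2 i ≤ lam.2 k := by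
      intro k hk
      rwa [show k = ⟨0, by omega⟩ from Fin.ext hk]
    have hL : ∀ k : Fin lam.1, (k : ℕ) = lam.1 - 1 → lam.2 k ≤ lam.2 j := by
      intro k hk
      obtain ⟨i', j', hij', hv', hk'⟩ := hlast k hk
      rwa [(unique_inverse_descent hides hij hv hij' hv').2]
    have e := hf.even_iff_top hij hv hF hL
    have e' := hf'.even_iff_top hij hv hF hL
    have h1 := (piEquiv_lt_iff n _ _).mp ((hf.2 x y).mp hxy)
    have h2 := (piEquiv_lt_iff n _ _).mp ((hf'.2 x y).mp hxy)
    have px : (f x : ℕ) % 2 = 0 ↔ (f' x : ℕ) % 2 = 0 := (e x).trans (e' x).symm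
    have py : (f y : ℕ) % 2 = 0 ↔ (f' y : ℕ) % 2 = 0 := (e y).trans (e' y).symm
    have hno : ¬ ((f x : ℕ) % 2 = 0 ∧ (f y : ℕ) % 2 = 1) := by
      rintro ⟨hx0, hy1⟩
      have h3 := (e y).mpr (((e x).mp hx0).trans hxy.le)
      omega
    rw [piEquiv_lt_iff]
    have mx : ((max (f x) (f' x) : Fin _) : ℕ) = max (f x : ℕ) (f' x) :=
      Fin.val_strictMono.monotone.map_max
    have my : ((max (f y) (f' y) : Fin _) : ℕ) = max (f y : ℕ) (f' y) :=
      Fin.val_strictMono.monotone.map_max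
    rw [mx, my]
    have := (f x).2
    have := (f' x).2
    omega
  refine ⟨fun x y hxy => max_lt_max (hf.1 hxy) (hf'.1 hxy), fun x y => ⟨main x y, fun hlt => ?_⟩⟩
  by_contra! hle
  rcases hle.eq_or_lt with heq | hgt
  · obtain rfl := lam.2.injective heq
    exact lt_irrefl _ hlt
  · exact lt_asymm hlt (main y x hgt)

end PPerm

end
end

section
/- Let n ≥ 2, let λ be a proper permutation of size m (with respect to π_n), and let g be an embedding into π_n of some permutation τ with λ ≤ τ ≤ π_n. Then the rightmost embedding of λ compatible with g is the pointwise maximum of all embeddings of λ compatible with g; that is, for every index i ∈ [m], its value at i equals the maximum of f(i) over all embeddings f of λ into π_n with Img(f) ⊆ Img(g). -/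
open scoped Classical

noncomputable section

namespace PPerm

/-- The 0-indexed values of `π_n`. -/
lemma piEquiv_val (n : ℕ) (p : Fin (2 * n + 2)) : ((piEquiv n) p : ℕ) =
    if (p : ℕ) = 0 then n else if (p : ℕ) = 2 * n + 1 then n + 1
    else if (p : ℕ) % 2 = 1 then (p : ℕ) / 2 else n + 1 + (p : ℕ) / 2 := by
  show piVal n ((p : ℕ) + 1) - 1 = _
  unfold piVal
  split_ifs <;> omega

lemma piEquiv_lt_of_mod_two_eq {n : ℕ} {p q : Fin (2 * n + 2)} (h : p < q)
    (hpar : (p : ℕ) % 2 = (q : ℕ) % 2) : (piEquiv n) p < (piEquiv n) q := by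
  rw [Fin.lt_def] at h ⊢
  have hp := p.2
  have hq := q.2
  rw [piEquiv_val, piEquiv_val]
  split_ifs <;> omega

lemma piEquiv_lt_iff_of_mod_two_eq {n : ℕ} {p q : Fin (2 * n + 2)}
    (hpar : (p : ℕ) % 2 = (q : ℕ) % 2) : (piEquiv n) p < (piEquiv n) q ↔ p < q := by
  refine ⟨fun h => ?_, fun h => piEquiv_lt_of_mod_two_eq h hpar⟩
  rcases lt_trichotomy p q with hlt | rfl | hgt
  · exact hlt
  · exact absurd h (lt_irrefl _)
  · exact absurd h (piEquiv_lt_of_mod_two_eq hgt hpar.symm).asymm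

/-- If `lam` has a unique inverse descent, its first element is a top element and its last
element is a bottom element, then the values of `lam` split at a position `i` in such a way
that every embedding of `lam` into `π_n` sends the upper part to even positions and the lower
part to odd positions (positions being 0-indexed). -/
lemma exists_parity_split {lam : PPerm} (hides : ides lam = 1)
    (hfirst : ∀ k : Fin lam.1, (k : ℕ) = 0 → IsTopPos lam k)
    (hlast : ∀ k : Fin lam.1, (k : ℕ) = lam.1 - 1 → IsBotPos lam k) (n : ℕ) :
    ∃ i : Fin lam.1, ∀ f : Fin lam.1 → Fin (2 * n + 2), IsEmb lam (piPerm n) f →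
      ∀ k, (lam.2 i ≤ lam.2 k → (f k : ℕ) % 2 = 0) ∧
        (lam.2 k < lam.2 i → (f k : ℕ) % 2 = 1) := by
  obtain ⟨hsub, ⟨⟨⟨i, j⟩, hij, hval⟩⟩⟩ := Nat.card_eq_one_iff_unique.mp hides
  simp only at hij hval
  have huniq : ∀ i' j' : Fin lam.1, i' < j' → (lam.2 i' : ℕ) = (lam.2 j' : ℕ) + 1 →
      i' = i ∧ j' = j := by
    intro i' j' h1 h2
    have h := congrArg Subtype.val (hsub.elim ⟨(i', j'), h1, h2⟩ ⟨(i, j), hij, hval⟩)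
    exact Prod.mk.inj h
  refine ⟨i, fun f hf k => ?_⟩
  have hmono : ∀ a b, lam.2 a < lam.2 b → (piEquiv n) (f a) < (piEquiv n) (f b) :=
    fun a b => (hf.2 a b).mp
  have hmono_le : ∀ a b, lam.2 a ≤ lam.2 b → (piEquiv n) (f a) ≤ (piEquiv n) (f b) :=
    fun a b hab => not_lt.mp fun h => absurd ((hf.2 b a).mpr h) (not_lt.mpr hab)
  have hdesc := hmono j i (by rw [Fin.lt_def]; omega)
  have hfij : f i < f j := hf.1 hij
  have hk := k.2
  have hfk := (f k).2
  have hfi := (f i).2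
  have hfj := (f j).2
  rw [Fin.lt_def] at hdesc hfij
  rw [piEquiv_val, piEquiv_val] at hdesc
  constructor
  · intro htop
    have hle := hmono_le i k htop
    have hne : (f k : ℕ) ≠ 2 * n + 1 := by
      intro hcon
      obtain ⟨i', j', h1, h2, h3⟩ := hlast ⟨lam.1 - 1, by omega⟩ rfl
      obtain ⟨rfl, rfl⟩ := huniq i' j' h1 h2
      have hkl : k ≠ ⟨lam.1 - 1, by omega⟩ := by
        intro heq
        rw [← heq] at h3
        rw [Fin.le_def] at htop h3
        omega
      have hlt : k < ⟨lam.1 - 1, by omega⟩ :=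
        lt_of_le_of_ne (by rw [Fin.le_def]; simp only; omega) hkl
      have h4 : f k < f ⟨lam.1 - 1, by omega⟩ := hf.1 hlt
      have h5 := (f ⟨lam.1 - 1, by omega⟩).2
      rw [Fin.lt_def] at h4
      omega
    rw [Fin.le_def, piEquiv_val, piEquiv_val] at hle
    split_ifs at hle hdesc <;> omega
  · intro hbot
    have hle := hmono_le k j (by rw [Fin.le_def]; rw [Fin.lt_def] at hbot; omega)
    have hne : (f k : ℕ) ≠ 0 := by
      intro hcon
      obtain ⟨i', j', h1, h2, h3⟩ := hfirst ⟨0, by omega⟩ rfl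
      obtain ⟨rfl, rfl⟩ := huniq i' j' h1 h2
      have hkl : k ≠ ⟨0, by omega⟩ := by
        intro heq
        rw [← heq] at h3
        exact absurd hbot (not_lt.mpr h3)
      have hlt : ⟨0, by omega⟩ < k :=
        lt_of_le_of_ne (by rw [Fin.le_def]; simp only; omega) hkl.symm
      have h4 : f ⟨0, by omega⟩ < f k := hf.1 hlt
      rw [Fin.lt_def] at h4
      omega
    rw [Fin.le_def, piEquiv_val, piEquiv_val] at hle
    split_ifs at hle hdesc <;> omega

/-- The pointwise maximum of two embeddings into `π_n` is again an embedding. -/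
lemma IsEmb.sup {lam : PPerm} (hides : ides lam = 1)
    (hfirst : ∀ k : Fin lam.1, (k : ℕ) = 0 → IsTopPos lam k)
    (hlast : ∀ k : Fin lam.1, (k : ℕ) = lam.1 - 1 → IsBotPos lam k) {n : ℕ}
    {f f' : Fin lam.1 → Fin (2 * n + 2)} (hf : IsEmb lam (piPerm n) f)
    (hf' : IsEmb lam (piPerm n) f') :
    IsEmb lam (piPerm n) (fun k => max (f k) (f' k)) := by
  obtain ⟨i, hi⟩ := exists_parity_split hides hfirst hlast n
  have hpar := hi f hf
  have hpar' := hi f' hf'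
  set h : Fin lam.1 → Fin (2 * n + 2) := fun k => max (f k) (f' k)
  have hcases : ∀ k, h k = f k ∨ h k = f' k := fun k => max_choice _ _
  have hparh : ∀ k, (lam.2 i ≤ lam.2 k → (h k : ℕ) % 2 = 0) ∧
      (lam.2 k < lam.2 i → (h k : ℕ) % 2 = 1) := by
    intro k
    rcases hcases k with hk | hk <;> rw [hk]
    · exact hpar k
    · exact hpar' k
  have hmono : StrictMono h := fun a b hab => max_lt_max (hf.1 hab) (hf'.1 hab)
  have hsame : ∀ a b, (f a : ℕ) % 2 = (f b : ℕ) % 2 → (h a : ℕ) % 2 = (h b : ℕ) % 2 →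
      lam.2 a < lam.2 b → (piEquiv n) (h a) < (piEquiv n) (h b) := by
    intro a b hab hab' hlt
    have hfab : f a < f b := (piEquiv_lt_iff_of_mod_two_eq hab).mp ((hf.2 a b).mp hlt)
    exact piEquiv_lt_of_mod_two_eq (hmono (hf.1.lt_iff_lt.mp hfab)) hab'
  have hcross : ∀ (e : Fin lam.1 → Fin (2 * n + 2)), IsEmb lam (piPerm n) e →
      ∀ a b, lam.2 a < lam.2 b → (e b : ℕ) ≤ h b → h a = e a →
      ¬ ((h a : ℕ) = 2 * n + 1 ∧ (h b : ℕ) = 0) := by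
    rintro e he a b hlt hle hea ⟨ha, hb⟩
    have hlt' : (piEquiv n) (e a) < (piEquiv n) (e b) := (he.2 a b).mp hlt
    rw [← hea, Fin.lt_def, piEquiv_val, piEquiv_val] at hlt'
    split_ifs at hlt' <;> omega
  have key : ∀ a b, lam.2 a < lam.2 b → (piEquiv n) (h a) < (piEquiv n) (h b) := by
    intro a b hlt
    rcases lt_or_ge (lam.2 a) (lam.2 i) with ha | ha
    · rcases lt_or_ge (lam.2 b) (lam.2 i) with hb | hb
      · exact hsame a b (((hpar a).2 ha).trans ((hpar b).2 hb).symm)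
          (((hparh a).2 ha).trans ((hparh b).2 hb).symm) hlt
      · have h1 := (hparh a).2 ha
        have h2 := (hparh b).1 hb
        have h3 : ¬ ((h a : ℕ) = 2 * n + 1 ∧ (h b : ℕ) = 0) := by
          rcases hcases a with hk | hk
          · exact hcross f hf a b hlt (Fin.le_def.mp (le_max_left _ _)) hk
          · exact hcross f' hf' a b hlt (Fin.le_def.mp (le_max_right _ _)) hk
        have h4 := (h a).2
        have h5 := (h b).2
        rw [Fin.lt_def, piEquiv_val, piEquiv_val]
        split_ifs <;> omega
    · have hb := ha.trans hlt.le
      exact hsame a b (((hpar a).1 ha).trans ((hpar b).1 hb).symm)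
        (((hparh a).1 ha).trans ((hparh b).1 hb).symm) hlt
  refine ⟨hmono, fun a b => ⟨key a b, fun hlt => ?_⟩⟩
  have hlt' : (piEquiv n) (h a) < (piEquiv n) (h b) := hlt
  rcases lt_trichotomy (lam.2 a) (lam.2 b) with hab | hab | hab
  · exact hab
  · obtain rfl := lam.2.injective hab
    exact absurd hlt' (lt_irrefl _)
  · exact absurd hlt' (key b a hab).asymm

/-- For `n ≥ 2`, a proper `λ`, and an embedding `g` into `π_n` of a
permutation `τ` with `λ ≤ τ ≤ π_n`: the rightmost embedding `f₀` of `λ` compatible with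
`g` is the pointwise maximum of all embeddings of `λ` compatible with `g`. -/
theorem rightmost_is_pointwise_max (n : ℕ) (hn : 2 ≤ n) (lam : PPerm)
    (hlam : IsProper n lam) (tau : PPerm) (hletau : Le lam tau)
    (g : Fin tau.1 → Fin (2 * n + 2)) (hg : IsEmb tau (piPerm n) g)
    (f0 : Fin lam.1 → Fin (2 * n + 2)) (hf0 : IsEmb lam (piPerm n) f0)
    (hcomp : Set.range f0 ⊆ Set.range g)
    (hmax : ∀ f, IsEmb lam (piPerm n) f → Set.range f ⊆ Set.range g → f ≠ f0 →
      LexLt f f0) :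
    ∀ f, IsEmb lam (piPerm n) f → Set.range f ⊆ Set.range g → ∀ i, f i ≤ f0 i := by
  intro f hf hfg i
  obtain ⟨-, -, -, hides, hfirst, -, -, hlast, -⟩ := hlam
  have hsup := IsEmb.sup hides hfirst hlast hf hf0
  by_contra hlt
  obtain ⟨k, hk, -⟩ := hmax _ hsup
    (by
      rintro _ ⟨k, rfl⟩
      show max (f k) (f0 k) ∈ Set.range g
      rcases max_choice (f k) (f0 k) with h | h
      · exact h.symm ▸ hfg ⟨k, rfl⟩
      · exact h.symm ▸ hcomp ⟨k, rfl⟩)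
    (fun h => hlt (max_eq_right_iff.mp (congrFun h i)))
  exact absurd hk (not_lt.mpr (le_max_right _ _))

end PPerm

end
end
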